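/- There exists a family of 8×8 real matrices J(t,s), defined for all real pairs (t,s) with t ≥ 1 and s² = t² − 1, such that for every such pair: (i) J(t,−s)ᵀ = J(t,s) (τ-Hermitian symmetry); (ii) U₈(t,−s)ᵀ · J(t,s) · U₈(t,s) = J(t,s) and C₈ᵀ · J(t,s) · C₈ = J(t,s); and (iii) det J(t,s) = 16(3 − 4t²)⁴ / (1 − 4t²)², which is nonzero for t ≥ 1, so J(t,s) is invertible and its determinant is the square of 4(3 − 4t²)²/(1 − 4t²). -/

import Mathlib

open Matrix

/-- The 8×8 matrix `U₈(t,s)` of the representation `ω`. -/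
def U8 (t s : ℝ) : Matrix (Fin 8) (Fin 8) ℝ :=
  !![1, 0, 0, 2*t, -(2*t), 2*t, 0, 0;
     0, 1, 0, t - s, -t + s, t - s, 1, 0;
     0, 0, 1, -1, 1, -1, 0, 0;
     0, 0, 1, 0, 0, 0, 0, 0;
     0, 0, 1, 0, 0, 1, -t + s, -t - s;
     0, 0, 1, -1, 0, 1, -t + s, -t - s;
     0, 0, 0, 0, 0, 0, 0, -1;
     0, 0, 0, 0, 0, 0, 1, 0]

/-- The 8×8 matrix `C₈` of the representation `ω` (independent of `t`, `s`). -/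
def C8 : Matrix (Fin 8) (Fin 8) ℝ :=
  !![0, 0, 1, 0, 0, 0, 0, 0;
     0, 0, 0, 1, 0, 0, 0, 0;
     1, 0, 0, 0, 0, 0, 0, 0;
     0, 1, 0, 0, 0, 0, 0, 0;
     0, 0, 0, 0, 0, 0, -1, 1;
     0, 0, 0, 0, 0, 0, -1, 0;
     0, 0, 0, 0, 0, -1, 0, 0;
     0, 0, 0, 0, 1, -1, 0, 0]

/-- A polynomial `τ`-Hermitian form invariant under `U8` and `C8` whenever `s ^ 2 = t ^ 2 - 1`. -/
def polyForm (t s : ℝ) : Matrix (Fin 8) (Fin 8) ℝ :=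
  !![0, 8 * t ^ 3 - 2 * t + s * (8 * t ^ 2 - 4), 8 * t ^ 2 - 2, -4 * t ^ 2 + 1 - 4 * t * s,
       -2 * t ^ 2 + 2 + 2 * t * s, 6 * t ^ 2 - 3 + 2 * t * s, -2 * s,
       -8 * t ^ 3 + 5 * t + s * (-8 * t ^ 2 + 3);
     8 * t ^ 3 - 2 * t + s * (-8 * t ^ 2 + 4), -16 * t ^ 3 + 4 * t, -4 * t ^ 2 + 1 + 4 * t * s,
       8 * t ^ 2 - 2, -4 * t ^ 2 + 1, -4 * t ^ 2 + 1, 0, 8 * t ^ 3 - 2 * t + s * (8 * t ^ 2 - 2);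
     8 * t ^ 2 - 2, -4 * t ^ 2 + 1 - 4 * t * s, 0, 8 * t ^ 3 - 2 * t + s * (8 * t ^ 2 - 4),
       -8 * t ^ 3 + 5 * t + s * (-8 * t ^ 2 + 3), 8 * t ^ 3 - 5 * t + s * (8 * t ^ 2 - 1),
       -4 * t ^ 2 + 1 - 4 * t * s, -2 * t ^ 2 + 2 + 2 * t * s;
     -4 * t ^ 2 + 1 + 4 * t * s, 8 * t ^ 2 - 2, 8 * t ^ 3 - 2 * t + s * (-8 * t ^ 2 + 4),
       -16 * t ^ 3 + 4 * t, 8 * t ^ 3 - 2 * t + s * (8 * t ^ 2 - 2),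
       -8 * t ^ 3 + 2 * t + s * (-8 * t ^ 2 + 2), 8 * t ^ 2 - 2, -4 * t ^ 2 + 1;
     -2 * t ^ 2 + 2 - 2 * t * s, -4 * t ^ 2 + 1, -8 * t ^ 3 + 5 * t + s * (8 * t ^ 2 - 3),
       8 * t ^ 3 - 2 * t + s * (-8 * t ^ 2 + 2), -8 * t ^ 3 + 2 * t, 8 * t ^ 3 - 2 * t,
       -4 * t ^ 2 + 1, 4 * t ^ 2 - 1;
     6 * t ^ 2 - 3 - 2 * t * s, -4 * t ^ 2 + 1, 8 * t ^ 3 - 5 * t + s * (-8 * t ^ 2 + 1),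
       -8 * t ^ 3 + 2 * t + s * (8 * t ^ 2 - 2), 8 * t ^ 3 - 2 * t, -8 * t ^ 3 + 2 * t, 0, 0;
     2 * s, 0, -4 * t ^ 2 + 1 + 4 * t * s, 8 * t ^ 2 - 2, -4 * t ^ 2 + 1, 0, 0, 0;
     -8 * t ^ 3 + 5 * t + s * (8 * t ^ 2 - 3), 8 * t ^ 3 - 2 * t + s * (-8 * t ^ 2 + 2),
       -2 * t ^ 2 + 2 - 2 * t * s, -4 * t ^ 2 + 1, 4 * t ^ 2 - 1, 0, 0, -8 * t ^ 3 + 2 * t]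

/-- The restriction of `polyForm` to the span of `e₀, e₁, e₄, e₅`. -/
def diagBlock (t s : ℝ) : Matrix (Fin 4) (Fin 4) ℝ :=
  !![0, 8 * t ^ 3 - 2 * t + s * (8 * t ^ 2 - 4), -2 * t ^ 2 + 2 + 2 * t * s,
       6 * t ^ 2 - 3 + 2 * t * s;
     8 * t ^ 3 - 2 * t + s * (-8 * t ^ 2 + 4), -16 * t ^ 3 + 4 * t, -4 * t ^ 2 + 1,
       -4 * t ^ 2 + 1;
     -2 * t ^ 2 + 2 - 2 * t * s, -4 * t ^ 2 + 1, -8 * t ^ 3 + 2 * t, 8 * t ^ 3 - 2 * t;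
     6 * t ^ 2 - 3 - 2 * t * s, -4 * t ^ 2 + 1, 8 * t ^ 3 - 2 * t, -8 * t ^ 3 + 2 * t]

/-- The pairing under `polyForm` of the span of `e₀, e₁, e₄, e₅` with its image under `C8`. -/
def offDiagBlock (t s : ℝ) : Matrix (Fin 4) (Fin 4) ℝ :=
  !![8 * t ^ 2 - 2, -4 * t ^ 2 + 1 - 4 * t * s, -8 * t ^ 3 + 5 * t + s * (-8 * t ^ 2 + 3),
       8 * t ^ 3 - 5 * t + s * (8 * t ^ 2 - 1);
     -4 * t ^ 2 + 1 + 4 * t * s, 8 * t ^ 2 - 2, 8 * t ^ 3 - 2 * t + s * (8 * t ^ 2 - 2),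
       -8 * t ^ 3 + 2 * t + s * (-8 * t ^ 2 + 2);
     -8 * t ^ 3 + 5 * t + s * (8 * t ^ 2 - 3), 8 * t ^ 3 - 2 * t + s * (-8 * t ^ 2 + 2),
       4 * t ^ 2 - 1, 0;
     8 * t ^ 3 - 5 * t + s * (-8 * t ^ 2 + 1), -8 * t ^ 3 + 2 * t + s * (8 * t ^ 2 - 2), 0, 0]

/-- The involutive change of basis that replaces `e₆` by `C8 e₅ = -e₆ - e₇`. -/
def symmBasis : Matrix (Fin 8) (Fin 8) ℝ :=
  !![1, 0, 0, 0, 0, 0, 0, 0;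
     0, 1, 0, 0, 0, 0, 0, 0;
     0, 0, 1, 0, 0, 0, 0, 0;
     0, 0, 0, 1, 0, 0, 0, 0;
     0, 0, 0, 0, 1, 0, 0, 0;
     0, 0, 0, 0, 0, 1, 0, 0;
     0, 0, 0, 0, 0, 0, -1, 0;
     0, 0, 0, 0, 0, 0, -1, 1]

/-- The labelling of the basis `symmBasis` by `e₀, e₁, e₄, e₅` and their images under `C8`. -/
def symmIndex : Fin 4 ⊕ Fin 4 ≃ Fin 8 where
  toFun := Sum.elim ![0, 1, 4, 5] ![2, 3, 7, 6]
  invFun := ![.inl 0, .inl 1, .inr 0, .inr 1, .inl 2, .inl 3, .inr 3, .inr 2]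
  left_inv := by decide
  right_inv := by decide

theorem det_fromBlocks_swap_invariant {n R : Type*} [Fintype n] [DecidableEq n] [CommRing R]
    (A B : Matrix n n R) : (fromBlocks A B B A).det = (A + B).det * (A - B).det := by
  have h : fromBlocks 1 1 0 1 * fromBlocks A B B A * fromBlocks 1 (-1) 0 1 =
      fromBlocks (A + B) 0 B (A - B) := by
    simp [fromBlocks_multiply, neg_add_eq_sub, add_comm B A]
  simpa using congrArg det h

theorem symmBasis_mul_self : symmBasis * symmBasis = 1 := by
  ext i j
  fin_cases i <;> fin_cases j <;> simp [symmBasis, mul_apply, Fin.sum_univ_eight]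

set_option maxHeartbeats 1000000 in
theorem polyForm_symmBasis (t s : ℝ) :
    (symmBasisᵀ * polyForm t s * symmBasis).submatrix symmIndex symmIndex =
      fromBlocks (diagBlock t s) (offDiagBlock t s) (offDiagBlock t s) (diagBlock t s) := by
  ext i j
  rcases i with i | i <;> rcases j with j | j <;> fin_cases i <;> fin_cases j <;>
    simp [symmBasis, symmIndex, polyForm, diagBlock, offDiagBlock, mul_apply,
      Fin.sum_univ_eight] <;> ring

theorem det_diagBlock_add {t s : ℝ} (h : s ^ 2 = t ^ 2 - 1) :
    (diagBlock t s + offDiagBlock t s).det =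
      (8 * t ^ 2 - 5) ^ 2 * (2 * t - 1) ^ 2 * (2 * t + 1) ^ 4 := by
  simp [diagBlock, offDiagBlock, det_succ_row_zero, Fin.sum_univ_succ, Fin.succAbove]
  grind

theorem det_diagBlock_sub {t s : ℝ} (h : s ^ 2 = t ^ 2 - 1) :
    (diagBlock t s - offDiagBlock t s).det =
      (8 * t ^ 2 - 5) ^ 2 * (2 * t - 1) ^ 4 * (2 * t + 1) ^ 2 := by
  simp [diagBlock, offDiagBlock, det_succ_row_zero, Fin.sum_univ_succ, Fin.succAbove]
  grind

theorem det_polyForm {t s : ℝ} (h : s ^ 2 = t ^ 2 - 1) :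
    (polyForm t s).det = (8 * t ^ 2 - 5) ^ 4 * (4 * t ^ 2 - 1) ^ 6 := by
  have hdet := congrArg det (polyForm_symmBasis t s)
  have hT := congrArg det symmBasis_mul_self
  rw [det_mul, det_one] at hT
  rw [det_submatrix_equiv_self, det_mul, det_mul, det_transpose, mul_right_comm, hT, one_mul,
    det_fromBlocks_swap_invariant, det_diagBlock_add h, det_diagBlock_sub h] at hdet
  rw [hdet]
  ring

theorem polyForm_transpose (t s : ℝ) : (polyForm t (-s))ᵀ = polyForm t s := by
  ext i j
  fin_cases i <;> fin_cases j <;> simp [polyForm] <;> ring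

set_option maxHeartbeats 1000000 in
theorem U8_polyForm_U8 {t s : ℝ} (h : s ^ 2 = t ^ 2 - 1) :
    (U8 t (-s))ᵀ * polyForm t s * U8 t s = polyForm t s := by
  ext i j
  fin_cases i <;> fin_cases j <;> simp [U8, polyForm, mul_apply, Fin.sum_univ_eight] <;> grind

set_option maxHeartbeats 1000000 in
theorem C8_polyForm_C8 (t s : ℝ) : C8ᵀ * polyForm t s * C8 = polyForm t s := by
  ext i j
  fin_cases i <;> fin_cases j <;> simp [C8, polyForm, mul_apply, Fin.sum_univ_eight] <;> ring

/-- The factor that normalizes the determinant of `polyForm`. -/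
noncomputable def normFactor (t : ℝ) : ℝ :=
  √(2 * (4 * t ^ 2 - 3) / (8 * t ^ 2 - 5)) / (4 * t ^ 2 - 1)

theorem normFactor_pow_eight {t : ℝ} (ht : 1 ≤ t) :
    normFactor t ^ 8 =
      (2 * (4 * t ^ 2 - 3) / (8 * t ^ 2 - 5)) ^ 4 / (4 * t ^ 2 - 1) ^ 8 := by
  have hpos : 0 ≤ 2 * (4 * t ^ 2 - 3) / (8 * t ^ 2 - 5) :=
    div_nonneg (by nlinarith) (by nlinarith)
  rw [normFactor, div_pow, show (8 : ℕ) = 2 * 4 from rfl, pow_mul √_, Real.sq_sqrt hpos]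

theorem det_normFactor_smul_polyForm {t s : ℝ} (ht : 1 ≤ t) (h : s ^ 2 = t ^ 2 - 1) :
    (normFactor t • polyForm t s).det = (4 * (3 - 4 * t ^ 2) ^ 2 / (1 - 4 * t ^ 2)) ^ 2 := by
  have h₁ : 8 * t ^ 2 - 5 ≠ 0 := by nlinarith
  have h₂ : 4 * t ^ 2 - 1 ≠ 0 := by nlinarith
  rw [det_smul, Fintype.card_fin, normFactor_pow_eight ht, det_polyForm h]
  rw [← neg_sub (4 * t ^ 2) 1, ← neg_sub (4 * t ^ 2) 3]
  generalize 8 * t ^ 2 - 5 = a, 4 * t ^ 2 - 1 = b, 4 * t ^ 2 - 3 = c at *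
  field_simp
  ring

/-- There is a family of 8×8 real matrices `J(t,s)`, defined for all real pairs
`(t,s)` with `t ≥ 1` and `s² = t² − 1`, such that (i) `J(t,−s)ᵀ = J(t,s)` (τ-Hermitian
symmetry); (ii) `U₈(t,−s)ᵀ · J(t,s) · U₈(t,s) = J(t,s)` and `C₈ᵀ · J(t,s) · C₈ = J(t,s)`;
and (iii) `det J(t,s) = 16(3 − 4t²)⁴/(1 − 4t²)²`, which is nonzero for `t ≥ 1`, so `J(t,s)`
is invertible and its determinant is the square of `4(3 − 4t²)²/(1 − 4t²)`. -/
theorem invariant_hermitian_form_eight_dim :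
    ∃ J : ℝ → ℝ → Matrix (Fin 8) (Fin 8) ℝ,
      ∀ t s : ℝ, 1 ≤ t → s ^ 2 = t ^ 2 - 1 →
        (J t (-s))ᵀ = J t s ∧
        (U8 t (-s))ᵀ * J t s * U8 t s = J t s ∧
        C8ᵀ * J t s * C8 = J t s ∧
        (J t s).det = 16 * (3 - 4 * t ^ 2) ^ 4 / (1 - 4 * t ^ 2) ^ 2 ∧
        (J t s).det ≠ 0 ∧ IsUnit (J t s) ∧
        (J t s).det = (4 * (3 - 4 * t ^ 2) ^ 2 / (1 - 4 * t ^ 2)) ^ 2 := by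
  refine ⟨fun t s => normFactor t • polyForm t s, fun t s ht h => ?_⟩
  have hdet := det_normFactor_smul_polyForm ht h
  have hne : (normFactor t • polyForm t s).det ≠ 0 := by
    rw [hdet]
    have h₁ : 3 - 4 * t ^ 2 ≠ 0 := by nlinarith
    have h₂ : 1 - 4 * t ^ 2 ≠ 0 := by nlinarith
    positivity
  refine ⟨?_, ?_, ?_, ?_, hne, ?_, hdet⟩
  · rw [transpose_smul, polyForm_transpose]
  · simp only [Matrix.mul_smul, Matrix.smul_mul, U8_polyForm_U8 h]
  · simp only [Matrix.mul_smul, Matrix.smul_mul, C8_polyForm_C8]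
  · rw [hdet, div_pow]
    ring
  · exact (isUnit_iff_isUnit_det _).2 hne.isUnit
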